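/- arXiv:2404.02379 — 11 statements merged into one kernel-verified Lean document; each statement's English description precedes it below -/
import Mathlib

section
/- Let U be an ultrafilter on ℕ, let π, f : ℕ → ℕ with f unbounded mod U (i.e. for every k ∈ ℕ the set {n : f(n) > k} belongs to U), let N ∈ ℕ, and let T be a family of subsets of ℕ with at least N elements. If ◇⁻(U,π,f,T) holds, then the set {m : π(m) < N} does not belong to U. -/
/-- `◇⁻(U, π, f, T)` for an ultrafilter `U` on `ℕ` (positivity = membership in `U`). -/
def DiamondMinusU (U : Ultrafilter ℕ) (π f : ℕ → ℕ) (T : Set (Set ℕ)) : Prop :=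
  ∃ 𝒜 : ℕ → Finset (Set ℕ),
    (∀ n, ∀ A ∈ 𝒜 n, A ⊆ Set.Iio (f n)) ∧
    (∀ n, (𝒜 n).card ≤ π n) ∧
    (∀ X ∈ T, {n | X ∩ Set.Iio (f n) ∈ 𝒜 n} ∈ U)

/-- If `f` is unbounded mod `U`, `T` has at least `N` elements, and `◇⁻(U, π, f, T)` holds,
then `π` is not bounded below `N` mod `U`. -/
theorem stmt3 (U : Ultrafilter ℕ) (π f : ℕ → ℕ)
    (hf : ∀ k : ℕ, {n | k < f n} ∈ U)
    (N : ℕ) (T : Set (Set ℕ)) (hT : (N : Cardinal) ≤ Cardinal.mk T)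
    (h : DiamondMinusU U π f T) :
    {m | π m < N} ∉ U := by
  classical
  intro hU
  obtain ⟨𝒜, -, hcard, hX⟩ := h
  have hc : Cardinal.mk (ULift.{0} (Fin N)) ≤ Cardinal.mk T := by simpa using hT
  obtain ⟨e⟩ := Cardinal.le_def _ _ |>.1 hc
  let g : Fin N → Set ℕ := fun i => (e ⟨i⟩ : Set ℕ)
  have hg : Function.Injective g := by
    intro i j hij
    have := e.injective (Subtype.ext hij)
    simpa using this
  have h1 : ∀ᶠ n in (U : Filter ℕ), ∀ i, g i ∩ Set.Iio (f n) ∈ 𝒜 n :=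
    Filter.eventually_all.2 fun i => hX _ (e ⟨i⟩).2
  have h2 : ∀ᶠ n in (U : Filter ℕ), ∀ i j, i ≠ j →
      g i ∩ Set.Iio (f n) ≠ g j ∩ Set.Iio (f n) := by
    refine Filter.eventually_all.2 fun i => Filter.eventually_all.2 fun j => ?_
    by_cases hij : i = j
    · exact Filter.Eventually.of_forall fun n hn => absurd hij hn
    · have hne : ∃ k, ¬ (k ∈ g i ↔ k ∈ g j) := by
        by_contra hcon
        push Not at hcon
        exact hij (hg (Set.ext hcon))
      obtain ⟨k, hk⟩ := hne
      have hk' : ∀ᶠ n in (U : Filter ℕ), k < f n := hf k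
      filter_upwards [hk'] with n hn _ heq
      apply hk
      have := Set.ext_iff.1 heq k
      simpa [hn] using this
  have h3 : ∀ᶠ n in (U : Filter ℕ), π n < N := hU
  obtain ⟨n, hn1, hn2, hn3⟩ := (h1.and (h2.and h3)).exists
  have hle : (Finset.univ : Finset (Fin N)).card ≤ (𝒜 n).card := by
    apply Finset.card_le_card_of_injOn (fun i => g i ∩ Set.Iio (f n))
    · intro i _
      exact hn1 i
    · intro i _ j _ hij
      by_contra hne
      exact hn2 i j hne hij
  have := hcard n
  simp at hle
  omega
end

section
/- Let λ be a cardinal and let U be an ultrafilter on ℕ such that ◇⁻_λ(U) holds. Then there is a family ⟨A_α : α < λ⟩ of elements of U such that for every countably infinite set I of indices α < λ, the intersection ⋂_{α ∈ I} A_α does not belong to U. -/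
/-- `sky(π) <_U sky(f)`: for every `h : ℕ → ℕ`, `{n | h (π n) < f n} ∈ U`. -/
def SkyLt (U : Ultrafilter ℕ) (π f : ℕ → ℕ) : Prop :=
  ∀ h : ℕ → ℕ, {n | h (π n) < f n} ∈ U

/-- `◇⁻_λ(U)`: there are `π, f` and a family `T` of subsets of `ℕ` of cardinality `λ`
with `sky(π) <_U sky(f)` and `◇⁻(U, π, f, T)`. -/
def DiamondMinusLambda (lam : Cardinal.{0}) (U : Ultrafilter ℕ) : Prop :=
  ∃ (π f : ℕ → ℕ) (T : Set (Set ℕ)),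
    Cardinal.mk T = lam ∧ SkyLt U π f ∧ DiamondMinusU U π f T

/-- `◇⁻_λ(U)` yields a `λ`-indexed family of members of `U` such that the intersection of
any countably infinite subfamily is not in `U`. -/
theorem stmt5 (lam : Cardinal.{0}) (U : Ultrafilter ℕ)
    (h : DiamondMinusLambda lam U) :
    ∃ (ι : Type) (A : ι → Set ℕ), Cardinal.mk ι = lam ∧
      (∀ i, A i ∈ U) ∧
      ∀ I : Set ι, I.Countable → I.Infinite → (⋂ i ∈ I, A i) ∉ U := by
  obtain ⟨π, f, T, hT, hsky, 𝒜, -, hcard, hmem⟩ := h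
  refine ⟨T, fun X => {n | X.1 ∩ Set.Iio (f n) ∈ 𝒜 n}, hT, fun X => hmem X.1 X.2, ?_⟩
  intro I _ hI hU
  let e := hI.natEmbedding
  let X : ℕ → Set ℕ := fun i => ((e i : I) : T).1
  have hX : ∀ i j, i ≠ j → ∃ m, ¬ (m ∈ X i ↔ m ∈ X j) := by
    intro i j hij
    by_contra! hc
    exact hij (e.injective (Subtype.ext (Subtype.ext (Set.ext hc))))
  have hd : ∀ i j, ∃ m, i ≠ j → ¬ (m ∈ X i ↔ m ∈ X j) := by
    intro i j
    by_cases hij : i = j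
    · exact ⟨0, fun h => absurd hij h⟩
    · obtain ⟨m, hm⟩ := hX i j hij
      exact ⟨m, fun _ => hm⟩
  choose d hd using hd
  let g : ℕ → ℕ := fun k =>
    (Finset.range (k + 1) ×ˢ Finset.range (k + 1)).sup fun p => d p.1 p.2
  obtain ⟨n, hn1, hn2⟩ := U.nonempty_of_mem (Filter.inter_mem hU (hsky g))
  have hn2 : g (π n) < f n := hn2
  have hmaps : ∀ i ∈ Finset.range (π n + 1), X i ∩ Set.Iio (f n) ∈ 𝒜 n := by
    intro i _
    exact Set.mem_iInter₂.1 hn1 (e i : I).1 (e i).2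
  have hinj : Set.InjOn (fun i => X i ∩ Set.Iio (f n)) (Finset.range (π n + 1)) := by
    intro i hi j hj hij
    by_contra hne
    have hle : d i j ≤ g (π n) :=
      Finset.le_sup (f := fun p : ℕ × ℕ => d p.1 p.2) (b := (i, j))
        (Finset.mem_product.2 ⟨hi, hj⟩)
    have hlt : d i j < f n := lt_of_le_of_lt hle hn2
    have := Set.ext_iff.1 hij (d i j)
    simp only [Set.mem_inter_iff, Set.mem_Iio, hlt, and_true] at this
    exact hd i j hne this
  have := Finset.card_le_card_of_injOn _ hmaps hinj
  have h2 := hcard n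
  rw [Finset.card_range] at this
  omega
end

section
/- Suppose F is a good filter on ℕ witnessed by π, f : ℕ → ℕ and a family T of subsets of ℕ, and let g : ℕ → ℕ be any function. Let B = {n : g(π(n)) < f(n)}. Then the filter generated by F ∪ {B} is a proper filter and is good, witnessed by the same π, f, T. -/
/-- `◇*(F, π, f, T)` for a filter `F` on `ℕ`: the guessing sets are in `F`. -/
def DiamondStar (F : Filter ℕ) (π f : ℕ → ℕ) (T : Set (Set ℕ)) : Prop :=
  ∃ 𝒜 : ℕ → Finset (Set ℕ),
    (∀ n, ∀ A ∈ 𝒜 n, A ⊆ Set.Iio (f n)) ∧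
    (∀ n, (𝒜 n).card ≤ π n) ∧
    (∀ X ∈ T, {n | X ∩ Set.Iio (f n) ∈ 𝒜 n} ∈ F)

/-- `F` is a good (proper) filter witnessed by `π, f, T`: `|T| = 𝔠`, `◇*(F, π, f, T)` holds,
and for every `g : ℕ → ℕ` the set `{n | g (π n) < f n}` is `F`-positive. -/
def GoodWitness (F : Filter ℕ) (π f : ℕ → ℕ) (T : Set (Set ℕ)) : Prop :=
  F.NeBot ∧ Cardinal.mk T = Cardinal.continuum ∧ DiamondStar F π f T ∧
    ∀ g : ℕ → ℕ, {n | g (π n) < f n}ᶜ ∉ F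

/-- Adding the set `B = {n | g (π n) < f n}` to a good filter yields a proper filter
which is again good, witnessed by the same `π, f, T`. -/
theorem stmt7 (F : Filter ℕ) (π f : ℕ → ℕ) (T : Set (Set ℕ))
    (h : GoodWitness F π f T) (g : ℕ → ℕ) :
    GoodWitness (F ⊓ Filter.principal {n | g (π n) < f n}) π f T := by
  obtain ⟨hF, hT, ⟨A, h1, h2, h3⟩, hg⟩ := h
  have key : ∀ g' : ℕ → ℕ, {n | g' (π n) < f n}ᶜ ∉ F ⊓ Filter.principal {n | g (π n) < f n} := by
    intro g' hmem
    rw [Filter.mem_inf_principal] at hmem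
    apply hg (fun k => max (g k) (g' k))
    filter_upwards [hmem] with n hn hlt
    have hlt' : max (g (π n)) (g' (π n)) < f n := hlt
    exact hn (lt_of_le_of_lt (le_max_left _ _) hlt') (lt_of_le_of_lt (le_max_right _ _) hlt')
  refine ⟨⟨fun hbot => ?_⟩, hT, ⟨A, h1, h2, fun X hX => Filter.mem_inf_of_left (h3 X hX)⟩, key⟩
  apply key g
  rw [hbot]
  exact Filter.mem_bot
end

section
/- There exists an ultrafilter U on ℕ such that ◇⁻(U) holds; that is, there are π, f : ℕ → ℕ, a family T of subsets of ℕ of cardinality 𝔠 = 2^{ℵ₀}, and a sequence ⟨𝒜_n : n ∈ ℕ⟩ where each 𝒜_n is a family of subsets of [0,f(n)) = {0,…,f(n)−1} with |𝒜_n| ≤ π(n), such that for every h : ℕ → ℕ the set {n : h(π(n)) < f(n)} belongs to U, and for every X ∈ T the set {n : X ∩ [0,f(n)) ∈ 𝒜_n} belongs to U. -/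
/-- There is an ultrafilter `U` on `ℕ` satisfying `◇⁻(U)`: there are `π, f : ℕ → ℕ`, a
family `T` of subsets of `ℕ` of cardinality `𝔠`, and families `𝒜 n` of subsets of
`[0, f n)` with `|𝒜 n| ≤ π n`, such that for every `h : ℕ → ℕ` the set
`{n | h (π n) < f n}` is in `U`, and every `X ∈ T` is guessed on a set in `U`. -/
theorem stmt11 :
    ∃ (U : Ultrafilter ℕ) (π f : ℕ → ℕ) (T : Set (Set ℕ)) (𝒜 : ℕ → Finset (Set ℕ)),
      Cardinal.mk T = Cardinal.continuum ∧
      (∀ n, ∀ A ∈ 𝒜 n, A ⊆ Set.Iio (f n)) ∧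
      (∀ n, (𝒜 n).card ≤ π n) ∧
      (∀ h : ℕ → ℕ, {n | h (π n) < f n} ∈ U) ∧
      (∀ X ∈ T, {n | X ∩ Set.Iio (f n) ∈ 𝒜 n} ∈ U) := by
  classical
  let d : ℕ → ℕ × Finset (Finset ℕ) := fun n => (Encodable.decode n).getD (0, ∅)
  have hd : Function.Surjective d := fun x => ⟨Encodable.encode x, by
    simp only [d, Encodable.encodek, Option.getD_some]⟩
  let π : ℕ → ℕ := fun n => (d n).2.card
  let f : ℕ → ℕ := fun n => (d n).1
  let 𝒜 : ℕ → Finset (Set ℕ) := fun n =>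
    (d n).2.image (fun s : Finset ℕ => (s : Set ℕ) ∩ Set.Iio (d n).1)
  let B : (ℕ → ℕ) × Finset (Set ℕ) → Set ℕ := fun p =>
    {n | p.1 (π n) < f n ∧ ∀ X ∈ p.2, X ∩ Set.Iio (f n) ∈ 𝒜 n}
  have hB : ∀ p, (B p).Nonempty := by
    rintro ⟨h, S⟩
    let k := ∑ i ∈ Finset.range (S.card + 1), h i + 1
    obtain ⟨n, hn⟩ := hd (k, S.image (fun X => (Finset.range k).filter (· ∈ X)))
    refine ⟨n, ?_, ?_⟩
    · simp only [π, f, hn]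
      apply Nat.lt_succ_of_le
      apply Finset.single_le_sum (f := h) (fun _ _ => Nat.zero_le _)
      rw [Finset.mem_range]
      exact Nat.lt_succ_of_le Finset.card_image_le
    · intro X hX
      simp only [𝒜, f, hn]
      refine Finset.mem_image.2 ⟨_, Finset.mem_image_of_mem _ hX, ?_⟩
      ext x
      simp
      tauto
  have hdir : Directed (· ≥ ·) (fun p => Filter.principal (B p)) := by
    rintro ⟨h, S⟩ ⟨h', S'⟩
    refine ⟨(fun i => max (h i) (h' i), S ∪ S'), ?_, ?_⟩
    · refine Filter.principal_mono.2 ?_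
      rintro n ⟨h1, h2⟩
      exact ⟨lt_of_le_of_lt (le_max_left _ _) h1,
        fun X hX => h2 X (Finset.mem_union_left _ hX)⟩
    · refine Filter.principal_mono.2 ?_
      rintro n ⟨h1, h2⟩
      exact ⟨lt_of_le_of_lt (le_max_right _ _) h1,
        fun X hX => h2 X (Finset.mem_union_right _ hX)⟩
  have hne : (⨅ p, Filter.principal (B p)).NeBot :=
    Filter.iInf_neBot_of_directed hdir (fun p => Filter.principal_neBot_iff.2 (hB p))
  let U := Ultrafilter.of (⨅ p, Filter.principal (B p))
  have hU : ∀ p, B p ∈ U := fun p =>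
    Ultrafilter.of_le _ (Filter.mem_iInf_of_mem p (Filter.mem_principal_self _))
  refine ⟨U, π, f, Set.univ, 𝒜, ?_, ?_, ?_, ?_, ?_⟩
  · simp
  · intro n A hA
    obtain ⟨s, -, rfl⟩ := Finset.mem_image.1 hA
    exact Set.inter_subset_right
  · exact fun n => Finset.card_image_le
  · exact fun h => Filter.mem_of_superset (hU (h, ∅)) (fun n hn => hn.1)
  · exact fun X _ => Filter.mem_of_superset (hU (fun _ => 0, {X}))
      (fun n hn => hn.2 X (Finset.mem_singleton_self X))
end

section
/- Let U be an ultrafilter on ℕ. Then ◇⁻(U) holds if and only if there exist π, f : ℕ → ℕ with sky(π) <_U sky(f) together with a perfect (π,f)-U-Kurepa system. -/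
/-- `◇⁻(U)`. -/
def DiamondMinusFull (U : Ultrafilter ℕ) : Prop :=
  ∃ (π f : ℕ → ℕ) (T : Set (Set ℕ)),
    Cardinal.mk T = Cardinal.continuum ∧ SkyLt U π f ∧ DiamondMinusU U π f T

/-- The tree order on the nodes `(n, b)` with `b ∈ 𝒜 n`:
`(n, b) < (m, c)` iff `n < m` and `b, c` agree below `min (f n) (f m)`. -/
def KurepaLt (f : ℕ → ℕ) (p q : ℕ × Set ℕ) : Prop :=
  p.1 < q.1 ∧ p.2 ∩ Set.Iio (min (f p.1) (f q.1)) = q.2 ∩ Set.Iio (min (f p.1) (f q.1))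

/-- A perfect `(π, f)`-`U`-Kurepa system: a sequence `⟨𝒜 n⟩` of families of subsets of
`[0, f n)` of size `≤ π n` such that every node has two incompatible extensions, and the
set of `U`-branches has cardinality continuum. -/
def PerfectUKurepa (U : Ultrafilter ℕ) (π f : ℕ → ℕ) (𝒜 : ℕ → Finset (Set ℕ)) : Prop :=
  (∀ n, ∀ A ∈ 𝒜 n, A ⊆ Set.Iio (f n)) ∧
  (∀ n, (𝒜 n).card ≤ π n) ∧
  (∀ n, ∀ b ∈ 𝒜 n, ∃ m₁, ∃ b₁ ∈ 𝒜 m₁, ∃ m₂, ∃ b₂ ∈ 𝒜 m₂,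
    KurepaLt f (n, b) (m₁, b₁) ∧ KurepaLt f (n, b) (m₂, b₂) ∧
    b₁ ∩ Set.Iio (min (f m₁) (f m₂)) ≠ b₂ ∩ Set.Iio (min (f m₁) (f m₂))) ∧
  Cardinal.mk {X : Set ℕ | {n | X ∩ Set.Iio (f n) ∈ 𝒜 n} ∈ U} = Cardinal.continuum

/-- `◇⁻(U)` holds iff there are `π, f` with `sky(π) <_U sky(f)` together with a perfect
`(π, f)`-`U`-Kurepa system. -/
theorem stmt13 (U : Ultrafilter ℕ) :
    DiamondMinusFull U ↔
      ∃ (π f : ℕ → ℕ), SkyLt U π f ∧ ∃ 𝒜 : ℕ → Finset (Set ℕ),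
        PerfectUKurepa U π f 𝒜 := by
  classical
  constructor
  · rintro ⟨π, f, T, hT, hs, 𝒜, hA, hc, hX⟩
    refine ⟨π, f, hs, ?_⟩
    -- the pruned system
    let cone : ℕ → Set ℕ → Set (Set ℕ) := fun n b => {X | X ∈ T ∧ X ∩ Set.Iio (f n) = b}
    let 𝒜' : ℕ → Finset (Set ℕ) := fun n => (𝒜 n).filter (fun b => ¬ (cone n b).Countable)
    let C : Set (Set ℕ) := ⋃ n, ⋃ b ∈ 𝒜 n, {X | X ∈ cone n b ∧ (cone n b).Countable}
    have hC : C.Countable := by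
      refine Set.countable_iUnion fun n => ?_
      refine Set.Countable.biUnion (𝒜 n).countable_toSet fun b _ => ?_
      by_cases h : (cone n b).Countable
      · exact h.mono fun X hX => hX.1
      · convert Set.countable_empty
        ext X
        simp [h]
    have hgood : ∀ X ∈ T \ C, {n | X ∩ Set.Iio (f n) ∈ 𝒜' n} ∈ U := by
      rintro X ⟨hXT, hXC⟩
      refine Filter.mem_of_superset (hX X hXT) fun n hn => ?_
      refine Finset.mem_filter.2 ⟨hn, fun hcount => hXC ?_⟩
      exact Set.mem_iUnion.2 ⟨n, Set.mem_iUnion₂.2 ⟨_, hn, ⟨hXT, rfl⟩, hcount⟩⟩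
    have hfk : ∀ k, {n | k < f n} ∈ U := fun k => hs fun _ => k
    have hgt : ∀ k, {n | k < n} ∈ U := by
      intro k
      by_contra hk
      have h1 : {n | k < n}ᶜ ∈ U := Ultrafilter.compl_mem_iff_notMem.2 hk
      have h2 := hfk ((Finset.range (k+1)).sup f)
      have h3 : ({n | k < n}ᶜ ∩ {n | (Finset.range (k+1)).sup f < f n}) ∈ U :=
        Filter.inter_mem h1 h2
      obtain ⟨n, hn1, hn2⟩ := U.nonempty_of_mem h3
      simp only [Set.mem_compl_iff, Set.mem_ofPred_eq, not_lt] at hn1 hn2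
      have := Finset.le_sup (f := f) (Finset.mem_range.2 (Nat.lt_succ_of_le hn1))
      exact absurd hn2 (not_lt.2 this)
    have hext : ∀ n k, ∀ X ∈ T \ C, ∃ m, n < m ∧ k < f m ∧ X ∩ Set.Iio (f m) ∈ 𝒜' m := by
      intro n k X hX'
      obtain ⟨m, ⟨h1, h2⟩, h3⟩ := U.nonempty_of_mem
        (Filter.inter_mem (Filter.inter_mem (hgt n) (hfk k)) (hgood X hX'))
      exact ⟨m, h1, h2, h3⟩
    refine ⟨𝒜', ?_, ?_, ?_, ?_⟩
    · intro n A h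
      exact hA n A (Finset.mem_filter.1 h).1
    · intro n
      exact (Finset.card_filter_le _ _).trans (hc n)
    · intro n b hb
      have hb2 := (Finset.mem_filter.1 hb).2
      have hnt : (cone n b \ C).Nontrivial := by
        by_contra hsub
        rw [Set.not_nontrivial_iff] at hsub
        apply hb2
        refine (hsub.countable.union hC).mono ?_
        intro X hX
        by_cases h : X ∈ C
        · exact Or.inr h
        · exact Or.inl ⟨hX, h⟩
      obtain ⟨X, ⟨⟨hXT, hXb⟩, hXC⟩, Y, ⟨⟨hYT, hYb⟩, hYC⟩, hne⟩ := hnt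
      obtain ⟨k, hk⟩ : ∃ k, ¬ (k ∈ X ↔ k ∈ Y) := by
        by_contra hcon
        push Not at hcon
        exact hne (Set.ext hcon)
      obtain ⟨m₁, hm1, hk1, hA1⟩ := hext n k X ⟨hXT, hXC⟩
      obtain ⟨m₂, hm2, hk2, hA2⟩ := hext n k Y ⟨hYT, hYC⟩
      refine ⟨m₁, _, hA1, m₂, _, hA2, ⟨hm1, ?_⟩, ⟨hm2, ?_⟩, ?_⟩
      · subst hXb
        ext j
        simp only [Set.mem_inter_iff, Set.mem_Iio, lt_min_iff]
        tauto
      · subst hYb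
        ext j
        simp only [Set.mem_inter_iff, Set.mem_Iio, lt_min_iff]
        tauto
      · intro heq
        have := Set.ext_iff.1 heq k
        simp only [Set.mem_inter_iff, Set.mem_Iio, lt_min_iff] at this
        tauto
    · apply le_antisymm
      · refine (Cardinal.mk_set_le _).trans ?_
        simp
      · refine le_trans ?_ (Cardinal.mk_le_mk_of_subset (s := T \ C) hgood)
        by_contra hlt
        rw [not_le] at hlt
        have hC' : Cardinal.mk C < Cardinal.continuum :=
          (Cardinal.le_aleph0_iff_set_countable.2 hC).trans_lt Cardinal.aleph0_lt_continuum
        have hsum := Cardinal.add_lt_of_lt Cardinal.aleph0_le_continuum hlt hC'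
        have hle : Cardinal.mk T ≤ Cardinal.mk ↑(T \ C) + Cardinal.mk C := by
          refine le_trans (Cardinal.mk_le_mk_of_subset ?_) (Cardinal.mk_union_le (T \ C) C)
          intro X hX
          by_cases h : X ∈ C
          · exact Or.inr h
          · exact Or.inl ⟨hX, h⟩
        rw [hT] at hle
        exact absurd hsum (not_lt.2 hle)
  · rintro ⟨π, f, hs, 𝒜, hA, hc, -, hk⟩
    exact ⟨π, f, _, hk, hs, 𝒜, hA, hc, fun X hX => hX⟩
end

section
/- Let U be an ultrafilter on ℕ, p : ℕ → ℕ, and let V = p_*(U) be the pushforward ultrafilter (B ∈ V iff p⁻¹(B) ∈ U). For every cardinal λ, if ◇⁻_λ(V) holds then ◇⁻_λ(U) holds. -/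
/-- `◇⁻_λ` pulls back along Rudin–Keisler reductions: if `V = p_*(U)` is the pushforward
of `U` (so `B ∈ V ↔ p ⁻¹' B ∈ U`) and `◇⁻_λ(V)` holds, then `◇⁻_λ(U)` holds. -/
theorem stmt14 (U : Ultrafilter ℕ) (p : ℕ → ℕ) (V : Ultrafilter ℕ)
    (hV : ∀ B : Set ℕ, B ∈ V ↔ p ⁻¹' B ∈ U)
    (lam : Cardinal.{0}) (h : DiamondMinusLambda lam V) :
    DiamondMinusLambda lam U := by
  obtain ⟨π, f, T, hT, hs, 𝒜, h1, h2, h3⟩ := h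
  exact ⟨π ∘ p, f ∘ p, T, hT, fun g => (hV _).1 (hs g), 𝒜 ∘ p,
    fun n => h1 (p n), fun n => h2 (p n), fun X hX => (hV _).1 (h3 X hX)⟩
end

section
/- Let U and ⟨U_i : i ∈ ℕ⟩ be ultrafilters on ℕ and let W = ∑_U U_i be their Fubini sum on ℕ×ℕ. Suppose B ∈ U and for each i there are π_i, f_i : ℕ → ℕ, a family T_i of subsets of ℕ, and a sequence ⟨𝒜^{(i)}_j : j ∈ ℕ⟩ such that for every i ∈ B these witness ◇⁻(U_i): each 𝒜^{(i)}_j is a family of subsets of [0,f_i(j)) with |𝒜^{(i)}_j| ≤ π_i(j), |T_i| = 𝔠, sky(π_i) <_{U_i} sky(f_i), and every X ∈ T_i satisfies {j : X ∩ [0,f_i(j)) ∈ 𝒜^{(i)}_j} ∈ U_i. Define π(i,j) = π_i(j), f(i,j) = f_i(j), and 𝒜_{(i,j)} = 𝒜^{(i)}_j. Then: (1) sky(π) <_W sky(f), i.e. for every h : ℕ → ℕ, {(i,j) : h(π(i,j)) < f(i,j)} ∈ W; (2) each 𝒜_{(i,j)} is a family of subsets of [0,f(i,j)) with |𝒜_{(i,j)}|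 ≤ π(i,j); (3) every Y ⊆ ℕ that is simultaneously guessed, i.e. {i : Y ∈ T_i} ∈ U, satisfies {(i,j) : Y ∩ [0,f(i,j)) ∈ 𝒜_{(i,j)}} ∈ W. In particular, if the set of simultaneously guessed Y has cardinality 𝔠, then ◇⁻(W) holds. -/
/-- `sky(π) <_W sky(f)` for an ultrafilter `W` on an arbitrary index set. -/
def SkyLtOn {α : Type} (W : Ultrafilter α) (π f : α → ℕ) : Prop :=
  ∀ h : ℕ → ℕ, {a | h (π a) < f a} ∈ W

/-- `◇⁻(W)` for an ultrafilter `W` on an arbitrary countable-or-other index set `α`. -/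
def DMFull {α : Type} (W : Ultrafilter α) : Prop :=
  ∃ (π f : α → ℕ) (T : Set (Set ℕ)) (𝒜 : α → Finset (Set ℕ)),
    Cardinal.mk T = Cardinal.continuum ∧
    (∀ a, ∀ A ∈ 𝒜 a, A ⊆ Set.Iio (f a)) ∧
    (∀ a, (𝒜 a).card ≤ π a) ∧
    SkyLtOn W π f ∧
    (∀ X ∈ T, {a | X ∩ Set.Iio (f a) ∈ 𝒜 a} ∈ W)

/-- Fubini-sum transfer of `◇⁻`-witnesses. `W = ∑_U U_i` is the Fubini sum (characterized
by `hW`). If `B ∈ U` and for each `i ∈ B` the data `π_i, f_i, T_i, 𝒜^{(i)}` witness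
`◇⁻(U_i)`, then with `π (i,j) = π_i j`, `f (i,j) = f_i j`, `𝒜_{(i,j)} = 𝒜^{(i)}_j`:
(1) `sky(π) <_W sky(f)`; (2) each `𝒜_{(i,j)}` is a family of `≤ π (i,j)` subsets of
`[0, f (i,j))`; (3) every `Y` simultaneously guessed (i.e. `{i | Y ∈ T_i} ∈ U`) is guessed
by the combined system on a `W`-large set. In particular if there are continuum many
simultaneously guessed `Y`'s, then `◇⁻(W)` holds. -/
theorem stmt15 (U : Ultrafilter ℕ) (Us : ℕ → Ultrafilter ℕ) (W : Ultrafilter (ℕ × ℕ))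
    (hW : ∀ A : Set (ℕ × ℕ), A ∈ W ↔ {i | {j | (i, j) ∈ A} ∈ Us i} ∈ U)
    (B : Set ℕ) (hB : B ∈ U)
    (πs fs : ℕ → ℕ → ℕ) (Ts : ℕ → Set (Set ℕ)) (As : ℕ → ℕ → Finset (Set ℕ))
    (hwit : ∀ i ∈ B,
      (∀ j, ∀ A ∈ As i j, A ⊆ Set.Iio (fs i j)) ∧
      (∀ j, (As i j).card ≤ πs i j) ∧
      Cardinal.mk (Ts i) = Cardinal.continuum ∧
      (∀ h : ℕ → ℕ, {j | h (πs i j) < fs i j} ∈ Us i) ∧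
      (∀ X ∈ Ts i, {j | X ∩ Set.Iio (fs i j) ∈ As i j} ∈ Us i)) :
    (∀ h : ℕ → ℕ, {p : ℕ × ℕ | h (πs p.1 p.2) < fs p.1 p.2} ∈ W) ∧
    (∀ i ∈ B, ∀ j, (∀ A ∈ As i j, A ⊆ Set.Iio (fs i j)) ∧ (As i j).card ≤ πs i j) ∧
    (∀ Y : Set ℕ, {i | Y ∈ Ts i} ∈ U →
      {p : ℕ × ℕ | Y ∩ Set.Iio (fs p.1 p.2) ∈ As p.1 p.2} ∈ W) ∧
    (Cardinal.mk {Y : Set ℕ | {i | Y ∈ Ts i} ∈ U} = Cardinal.continuum → DMFull W) := by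
  classical
  have h1 : ∀ h : ℕ → ℕ, {p : ℕ × ℕ | h (πs p.1 p.2) < fs p.1 p.2} ∈ W := by
    intro h
    rw [hW]
    exact Filter.mem_of_superset hB (fun i hi => (hwit i hi).2.2.2.1 h)
  have h3 : ∀ Y : Set ℕ, {i | Y ∈ Ts i} ∈ U →
      {p : ℕ × ℕ | Y ∩ Set.Iio (fs p.1 p.2) ∈ As p.1 p.2} ∈ W := by
    intro Y hY
    rw [hW]
    exact Filter.mem_of_superset (Filter.inter_mem hB hY)
      (fun i hi => (hwit i hi.1).2.2.2.2 Y hi.2)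
  have hBW : {p : ℕ × ℕ | p.1 ∈ B} ∈ W := by
    rw [hW]
    refine Filter.mem_of_superset hB (fun i hi => ?_)
    exact Filter.mem_of_superset Filter.univ_mem (fun j _ => hi)
  refine ⟨h1, fun i hi j => ⟨(hwit i hi).1 j, (hwit i hi).2.1 j⟩, h3, fun hc => ?_⟩
  refine ⟨fun p => πs p.1 p.2, fun p => fs p.1 p.2, {Y : Set ℕ | {i | Y ∈ Ts i} ∈ U},
    fun p => if p.1 ∈ B then As p.1 p.2 else ∅, hc, ?_, ?_, h1, ?_⟩
  · intro a A hA
    by_cases ha : a.1 ∈ B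
    · simp only [ha, if_true] at hA
      exact (hwit a.1 ha).1 a.2 A hA
    · simp [ha] at hA
  · intro a
    by_cases ha : a.1 ∈ B
    · simp only [ha, if_true]
      exact (hwit a.1 ha).2.1 a.2
    · simp [ha]
  · intro X hX
    refine Filter.mem_of_superset (Filter.inter_mem hBW (h3 X hX)) ?_
    rintro a ⟨ha, hb⟩
    have ha' : a.1 ∈ B := ha
    simp only [Set.mem_setOf_eq, ha', if_true]
    exact hb
end

section
/- Let U and V be ultrafilters on ℕ. If ◇⁻(U) and ◇⁻(V) hold, then ◇⁻(U·V) holds, where U·V is the Fubini product on ℕ×ℕ. -/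
/-- If `◇⁻(U)` and `◇⁻(V)` hold, then `◇⁻(U·V)` holds, where `U·V` is the Fubini product
on `ℕ × ℕ` (characterized by `hW`). -/
theorem stmt16 (U V : Ultrafilter ℕ) (W : Ultrafilter (ℕ × ℕ))
    (hW : ∀ A : Set (ℕ × ℕ), A ∈ W ↔ {i | {j | (i, j) ∈ A} ∈ V} ∈ U)
    (hU : DMFull U) (hV : DMFull V) :
    DMFull W := by
  -- Pull the witnesses for `V` back along the second projection.
  obtain ⟨π, f, T, 𝒜, hT, hsub, hcard, hsky, hguess⟩ := hV
  have key : ∀ B : Set ℕ, B ∈ V → {a : ℕ × ℕ | a.2 ∈ B} ∈ W := by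
    intro B hB
    rw [hW]
    exact Filter.mem_of_superset Filter.univ_mem (fun i _ => hB)
  exact ⟨fun a => π a.2, fun a => f a.2, T, fun a => 𝒜 a.2, hT, fun a => hsub a.2,
    fun a => hcard a.2, fun h => key _ (hsky h), fun X hX => key _ (hguess X hX)⟩
end

section
/- Let U and ⟨U_n : n ∈ ℕ⟩ be ultrafilters on ℕ and let W = ∑_U U_n be their Fubini sum on ℕ×ℕ. If ◇⁻(W) holds, then either ◇⁻(U) holds, or the set {n : ◇⁻(U_n) holds} belongs to U. -/
open Filter in
theorem aux_fin {β : Type} (V : Ultrafilter ℕ) (g : ℕ → β) (s : Set β) (hs : s.Finite)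
    (h : ∀ᶠ j in (V : Filter ℕ), g j ∈ s) : ∃ c ∈ s, ∀ᶠ j in (V : Filter ℕ), g j = c := by
  have h1 : (⋃ c ∈ s, {j | g j = c}) ∈ V := by
    refine Filter.mem_of_superset (f := (V : Filter ℕ)) h ?_
    intro j hj
    simpa using hj
  rw [Ultrafilter.finite_biUnion_mem_iff hs] at h1
  exact h1

theorem aux_unbdd (V : Ultrafilter ℕ) (g : ℕ → ℕ)
    (h : ¬ ∃ c, ∀ᶠ j in (V : Filter ℕ), g j = c) (N : ℕ) : ∀ᶠ j in (V : Filter ℕ), N < g j := by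
  by_contra hN
  have h2 : ∀ᶠ j in (V : Filter ℕ), ¬ N < g j := Ultrafilter.eventually_not.2 hN
  obtain ⟨c, -, hc⟩ := aux_fin V g (Set.Iic N) (Set.finite_Iic N)
    (h2.mono fun j hj => by simpa using hj)
  exact h ⟨c, hc⟩

theorem aux_finite (V : Ultrafilter ℕ) (f : ℕ → ℕ) (A : ℕ → Finset (Set ℕ)) (p : ℕ)
    (hp : ∀ᶠ j in (V : Filter ℕ), (A j).card ≤ p)
    (hf : ∀ N, ∀ᶠ j in (V : Filter ℕ), N < f j) :
    {X : Set ℕ | ∀ᶠ j in (V : Filter ℕ), X ∩ Set.Iio (f j) ∈ A j}.Finite := by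
  classical
  by_contra hinf
  obtain ⟨t, ht, hcard⟩ := Set.Infinite.exists_subset_card_eq hinf (p + 1)
  have h1 : ∀ᶠ j in (V : Filter ℕ), ∀ X ∈ t, X ∩ Set.Iio (f j) ∈ A j :=
    (Filter.eventually_all_finset t).2 fun X hX => ht hX
  have h2 : ∀ᶠ j in (V : Filter ℕ), ∀ q ∈ t.offDiag,
      q.1 ∩ Set.Iio (f j) ≠ q.2 ∩ Set.Iio (f j) := by
    refine (Filter.eventually_all_finset _).2 fun q hq => ?_
    have hne : q.1 ≠ q.2 := (Finset.mem_offDiag.1 hq).2.2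
    obtain ⟨m, hm⟩ : ∃ m, ¬ (m ∈ q.1 ↔ m ∈ q.2) := by
      by_contra hcon
      push Not at hcon
      exact hne (Set.ext hcon)
    refine (hf m).mono fun j hj heq => hm ?_
    have := Set.ext_iff.1 heq m
    simpa [hj] using this
  obtain ⟨j, hj1, hj2, hj3⟩ := (h1.and (h2.and hp)).exists
  have : t.card ≤ (A j).card := by
    refine Finset.card_le_card_of_injOn (fun X => X ∩ Set.Iio (f j)) hj1 ?_
    intro X hX Y hY hXY
    by_contra hne
    exact hj2 (X, Y) (Finset.mem_offDiag.2 ⟨hX, hY, hne⟩) hXY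
  omega

theorem aux_card (T : Set (Set ℕ)) (S : ℕ → Set (Set ℕ)) (hT : Cardinal.mk T = Cardinal.continuum)
    (hS : ∀ i, Cardinal.mk (S i) < Cardinal.continuum) (hTS : T ⊆ ⋃ i, S i) : False := by
  have h1 : Cardinal.mk T ≤ Cardinal.sum fun i => Cardinal.mk (S i) :=
    (Cardinal.mk_le_mk_of_subset hTS).trans (Cardinal.mk_iUnion_le_sum_mk)
  have h2 := Cardinal.sum_lt_prod (fun i => Cardinal.mk (S i)) (fun _ => Cardinal.continuum) hS
  rw [Cardinal.prod_const] at h2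
  simp at h2
  rw [hT] at h1
  exact absurd h2 (not_lt.2 h1)

theorem stmt17 (U : Ultrafilter ℕ) (Us : ℕ → Ultrafilter ℕ) (W : Ultrafilter (ℕ × ℕ))
    (hW : ∀ A : Set (ℕ × ℕ), A ∈ W ↔ {i | {j | (i, j) ∈ A} ∈ Us i} ∈ U)
    (h : DMFull W) :
    DMFull U ∨ {n | DMFull (Us n)} ∈ U := by
  classical
  obtain ⟨π, f, T, A, hT, hA, hcard, hsky, hX⟩ := h
  let S : ℕ → Set (Set ℕ) := fun i =>
    {X | ∀ᶠ j in (Us i : Filter ℕ), X ∩ Set.Iio (f (i, j)) ∈ A (i, j)}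
  have hXS : ∀ X ∈ T, ∀ᶠ i in (U : Filter ℕ), X ∈ S i := fun X hXT => (hW _).1 (hX X hXT)
  have hsky' : ∀ h : ℕ → ℕ, ∀ᶠ i in (U : Filter ℕ), ∀ᶠ j in (Us i : Filter ℕ),
      h (π (i, j)) < f (i, j) := fun h => (hW _).1 (hsky h)
  have hle : ∀ R : Set (Set ℕ), Cardinal.mk R ≤ Cardinal.continuum := fun R =>
    (Cardinal.mk_set_le R).trans (by simp)
  have hE : ∀ᶠ i in (U : Filter ℕ), Cardinal.mk (S i) = Cardinal.continuum := by
    by_contra hcon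
    have hcon' := Ultrafilter.eventually_not.2 hcon
    refine aux_card T (fun i => if Cardinal.mk (S i) = Cardinal.continuum then ∅ else S i) hT ?_ ?_
    · intro i
      split_ifs with hi
      · simpa using Cardinal.continuum_pos
      · exact lt_of_le_of_ne (hle _) hi
    · intro X hXT
      obtain ⟨i, hi1, hi2⟩ := (hcon'.and (hXS X hXT)).exists
      refine Set.mem_iUnion.2 ⟨i, ?_⟩
      rw [if_neg hi1]
      exact hi2
  by_cases hC : ∀ᶠ i in (U : Filter ℕ), ∃ p, ∀ᶠ j in (Us i : Filter ℕ), π (i, j) = p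
  · left
    have key : ∀ᶠ i in (U : Filter ℕ), ∃ q : ℕ × ℕ × Finset (Set ℕ),
        ∀ᶠ j in (Us i : Filter ℕ), π (i, j) = q.1 ∧ f (i, j) = q.2.1 ∧ A (i, j) = q.2.2 := by
      filter_upwards [hE, hC] with i hi ⟨p, hp⟩
      have hfc : ∃ g, ∀ᶠ j in (Us i : Filter ℕ), f (i, j) = g := by
        by_contra hcon
        have hfin := aux_finite (Us i) (fun j => f (i, j)) (fun j => A (i, j)) p
          (hp.mono fun j hj => hj ▸ hcard (i, j))
          (aux_unbdd (Us i) (fun j => f (i, j)) hcon)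
        have : Cardinal.mk (S i) < Cardinal.aleph0 := Cardinal.lt_aleph0_iff_set_finite.2 hfin
        rw [hi] at this
        exact absurd this (not_lt.2 Cardinal.aleph0_le_continuum)
      obtain ⟨g, hg⟩ := hfc
      have hfin : {B : Finset (Set ℕ) | (B : Set (Set ℕ)) ⊆ 𝒫 (Set.Iio g)}.Finite := by
        have h0 : (𝒫 (Set.Iio g)).Finite := (Set.finite_Iio g).finite_subsets
        exact (h0.finite_subsets).preimage (Finset.coe_injective.injOn)
      obtain ⟨B, -, hB⟩ := aux_fin (Us i) (fun j => A (i, j)) _ hfin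
        (hg.mono fun j hj X hXA => by
          have := hA (i, j) X hXA
          rw [hj] at this
          exact this)
      exact ⟨(p, g, B), hp.and (hg.and hB)⟩
    let q : ℕ → ℕ × ℕ × Finset (Set ℕ) := fun i =>
      if hq : ∃ q : ℕ × ℕ × Finset (Set ℕ), ∀ᶠ j in (Us i : Filter ℕ),
        π (i, j) = q.1 ∧ f (i, j) = q.2.1 ∧ A (i, j) = q.2.2 then hq.choose else (0, 0, ∅)
    have hq : ∀ i, q i = (0, 0, ∅) ∨ ∀ᶠ j in (Us i : Filter ℕ),
        π (i, j) = (q i).1 ∧ f (i, j) = (q i).2.1 ∧ A (i, j) = (q i).2.2 := by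
      intro i
      by_cases hi : ∃ q : ℕ × ℕ × Finset (Set ℕ), ∀ᶠ j in (Us i : Filter ℕ),
        π (i, j) = q.1 ∧ f (i, j) = q.2.1 ∧ A (i, j) = q.2.2
      · right
        have : q i = hi.choose := dif_pos hi
        rw [this]
        exact hi.choose_spec
      · left
        exact dif_neg hi
    have hq' : ∀ᶠ i in (U : Filter ℕ), ∀ᶠ j in (Us i : Filter ℕ),
        π (i, j) = (q i).1 ∧ f (i, j) = (q i).2.1 ∧ A (i, j) = (q i).2.2 := by
      filter_upwards [key] with i hi
      have : q i = hi.choose := dif_pos hi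
      rw [this]
      exact hi.choose_spec
    refine ⟨fun i => (q i).1, fun i => (q i).2.1, T, fun i => (q i).2.2, hT, ?_, ?_, ?_, ?_⟩
    · intro i X hXq
      rcases hq i with h0 | h0
      · simp [h0] at hXq
      · obtain ⟨j, h1, h2, h3⟩ := h0.exists
        change X ∈ (q i).2.2 at hXq
        change X ⊆ Set.Iio (q i).2.1
        rw [← h2]
        rw [← h3] at hXq
        exact hA _ _ hXq
    · intro i
      rcases hq i with h0 | h0
      · simp [h0]
      · obtain ⟨j, h1, h2, h3⟩ := h0.exists
        simp only [← h1, ← h3]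
        exact hcard _
    · intro h
      filter_upwards [hq', hsky' h] with i h1 h2
      obtain ⟨j, ⟨h3, h4, h5⟩, h6⟩ := (h1.and h2).exists
      rw [h3, h4] at h6
      exact h6
    · intro X hXT
      filter_upwards [hq', hXS X hXT] with i h1 h2
      obtain ⟨j, ⟨h3, h4, h5⟩, h6⟩ := (h1.and h2).exists
      rw [h4, h5] at h6
      exact h6
  · right
    have hC' := Ultrafilter.eventually_not.2 hC
    have hS : ∀ᶠ i in (U : Filter ℕ), ∀ h : ℕ → ℕ, ∀ᶠ j in (Us i : Filter ℕ),
        h (π (i, j)) < f (i, j) := by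
      by_contra hcon
      have hcon' := Ultrafilter.eventually_not.2 hcon
      have : ∀ i, ∃ h : ℕ → ℕ, (¬ ∀ h : ℕ → ℕ, ∀ᶠ j in (Us i : Filter ℕ),
        h (π (i, j)) < f (i, j)) → ¬ ∀ᶠ j in (Us i : Filter ℕ), h (π (i, j)) < f (i, j) := by
        intro i
        by_cases hi : ∀ h : ℕ → ℕ, ∀ᶠ j in (Us i : Filter ℕ), h (π (i, j)) < f (i, j)
        · exact ⟨id, fun h => absurd hi h⟩
        · obtain ⟨h, hh⟩ := not_forall.1 hi
          exact ⟨h, fun _ => hh⟩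
      choose H hH using this
      obtain ⟨i, h1, h2, h3⟩ := (hcon'.and (hC'.and
        (hsky' fun n => (Finset.range (n + 1)).sup fun i => H i n))).exists
      refine hH i h1 ?_
      filter_upwards [h3, aux_unbdd (Us i) (fun j => π (i, j)) h2 i] with j h4 h5
      refine lt_of_le_of_lt ?_ h4
      exact Finset.le_sup (f := fun k => H k (π (i, j)))
        (Finset.mem_range.2 (by omega))
    filter_upwards [hS, hE] with i h1 h2
    exact ⟨fun j => π (i, j), fun j => f (i, j), S i, fun j => A (i, j), h2,
      fun j => hA (i, j), fun j => hcard (i, j), h1, fun X hX => hX⟩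
end

section
/- Assume the Continuum Hypothesis (2^{ℵ₀} = ℵ₁). Then there exists an ultrafilter U on ℕ such that: (a) U is a q-point, i.e. for every partition ⟨I_n : n ∈ ℕ⟩ of ℕ into finite sets there is X ∈ U with |X ∩ I_n| ≤ 1 for all n; and (b) U is Tukey-top, witnessed by a family ⟨A_α : α < 𝔠⟩ of elements of U such that for every countably infinite set I of indices α < 𝔠, the intersection ⋂_{α ∈ I} A_α does not belong to U. -/
namespace QTop

/-- Injective choice from a sequence of infinite sets. -/
lemma exists_inj_choice (D : ℕ → Set ℕ) (hD : ∀ j, (D j).Infinite) :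
    ∃ y : ℕ → ℕ, Function.Injective y ∧ ∀ j, y j ∈ D j := by
  have h : ∀ (j : ℕ) (s : Finset ℕ), ∃ a ∈ D j, a ∉ s :=
    fun j s => (hD j).exists_notMem_finset s
  choose pick hp1 hp2 using h
  let st : ℕ → Finset ℕ := fun n => Nat.rec ∅ (fun j s => insert (pick j s) s) n
  have hst : ∀ j, st (j + 1) = insert (pick j (st j)) (st j) := fun j => rfl
  have hmono : Monotone st := monotone_nat_of_le_succ fun j => by
    rw [hst]; exact Finset.subset_insert _ _
  refine ⟨fun j => pick j (st j), ?_, fun j => hp1 _ _⟩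
  have key : ∀ i j, i < j → pick i (st i) ≠ pick j (st j) := by
    intro i j hij heq
    apply hp2 j (st j)
    rw [← heq]
    apply hmono (show i + 1 ≤ j from hij)
    rw [hst]
    exact Finset.mem_insert_self _ _
  intro i j hij
  rcases lt_trichotomy i j with h | h | h
  · exact absurd hij (key i j h)
  · exact h
  · exact absurd hij.symm (key j i h)

/-- A partition of `ℕ` into finite sets. -/
def IsPart (I : ℕ → Set ℕ) : Prop :=
  (Pairwise fun m n => Disjoint (I m) (I n)) ∧ (∀ n, (I n).Finite) ∧ (⋃ n, I n) = Set.univ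

lemma exists_selector (I : ℕ → Set ℕ) (hI : IsPart I) (C : Set (Set ℕ)) (hC : C.Countable)
    (hinf : ∀ c ∈ C, c.Infinite) :
    ∃ X : Set ℕ, (∀ n, (X ∩ I n).Subsingleton) ∧ ∀ c ∈ C, (X ∩ c).Infinite := by
  obtain ⟨hdis, hfin, hun⟩ := hI
  rcases C.eq_empty_or_nonempty with rfl | hne
  · exact ⟨∅, by simp, by simp⟩
  obtain ⟨f, hf⟩ := hC.exists_eq_range hne
  have hb : ∀ x, ∃ n, x ∈ I n := fun x => by
    have : x ∈ ⋃ n, I n := hun ▸ Set.mem_univ x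
    simpa using this
  choose blk hblk using hb
  have huniq : ∀ x n, x ∈ I n → blk x = n := by
    intro x n hx
    by_contra h
    exact Set.disjoint_left.1 (hdis h) (hblk x) hx
  have hfinf : ∀ i, (f i).Infinite := fun i => hinf _ (hf ▸ Set.mem_range_self i)
  have hD : ∀ j : ℕ, (blk '' f (Nat.unpair j).1).Infinite := by
    intro j hfi
    refine hfinf (Nat.unpair j).1 ((hfi.biUnion (fun n _ => hfin n)).subset ?_)
    intro x hx
    exact Set.mem_biUnion (Set.mem_image_of_mem _ hx) (hblk x)
  obtain ⟨y, hyi, hy⟩ := exists_inj_choice _ hD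
  choose x hx1 hx2 using hy
  refine ⟨Set.range x, ?_, ?_⟩
  · rintro n a ⟨⟨i, rfl⟩, hi⟩ b ⟨⟨j, rfl⟩, hj⟩
    have h1 := huniq _ _ hi
    have h2 := huniq _ _ hj
    rw [hx2] at h1 h2
    rw [hyi (h1.trans h2.symm)]
  · intro c hc
    rw [hf] at hc
    obtain ⟨i, rfl⟩ := hc
    have hinj : Function.Injective (fun k => x (Nat.pair i k)) := by
      intro k l hkl
      have h := congrArg blk hkl
      simp only [hx2] at h
      have := hyi h
      simpa using this
    refine (Set.infinite_range_of_injective hinj).mono ?_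
    rintro _ ⟨k, rfl⟩
    refine ⟨⟨_, rfl⟩, ?_⟩
    have := hx1 (Nat.pair i k)
    simpa using this

/-- The transfinite construction. -/
lemma exists_tower {P : Type} [LinearOrder P] [WellFoundedLT P]
    (hcount : ∀ p : P, (Set.Iio p).Countable) (I : P → ℕ → Set ℕ) (hI : ∀ p, IsPart (I p))
    {K : Type} [Countable K] (B : K → Set ℕ) (hB : ∀ c, (B c).Infinite) :
    ∃ X : P → Set ℕ, (∀ p n, (X p ∩ I p n).Subsingleton) ∧
      ∀ (s : Finset P) (c : K), ((⋂ q ∈ s, X q) ∩ B c).Infinite := by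
  let Cset : (p : P) → ((q : P) → q < p → Set ℕ) → Set (Set ℕ) := fun p F =>
    {C | C.Infinite ∧ ∃ (s : Finset (Set.Iio p)) (c : K),
      C = (⋂ q ∈ s, F q.1 q.2) ∩ B c}
  have hstep : ∀ (p : P) (F : (q : P) → q < p → Set ℕ), ∃ X : Set ℕ,
      (∀ n, (X ∩ I p n).Subsingleton) ∧ ∀ C ∈ Cset p F, (X ∩ C).Infinite := by
    intro p F
    refine exists_selector (I p) (hI p) _ ?_ (fun c hc => hc.1)
    have : Countable (Set.Iio p) := hcount p
    refine (Set.countable_range (fun sc : Finset (Set.Iio p) × K =>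
      (⋂ q ∈ sc.1, F q.1 q.2) ∩ B sc.2)).mono ?_
    rintro C ⟨-, s, c, rfl⟩
    exact ⟨(s, c), rfl⟩
  choose step hs1 hs2 using hstep
  have wf : WellFounded (fun a b : P => a < b) := wellFounded_lt
  obtain ⟨X, hX⟩ : ∃ X : P → Set ℕ, ∀ p, X p = step p (fun q _ => X q) :=
    ⟨wf.fix step, fun p => wf.fix_eq step p⟩
  refine ⟨X, fun p n => by rw [hX]; exact hs1 _ _ n, ?_⟩
  intro s c
  classical
  induction s using Finset.induction_on_max with
  | empty => simpa using hB c
  | insert p s hlt ih =>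
    have hmem : ((⋂ q ∈ s, X q) ∩ B c) ∈ Cset p (fun q _ => X q) := by
      refine ⟨ih, s.subtype (fun q => q ∈ Set.Iio p), c, ?_⟩
      congr 1
      ext m
      simp only [Set.mem_iInter, Finset.mem_subtype]
      exact ⟨fun h q hq => h q.1 hq, fun h q hq => h ⟨q, hlt q hq⟩ hq⟩
    have := hs2 p (fun q _ => X q) _ hmem
    rw [← hX] at this
    rw [Finset.set_biInter_insert, Set.inter_assoc]
    exact this

/-- An independent family of size continuum with a countable dense family of infinite sets. -/
lemma exists_indep : ∃ (A : (ℕ → Bool) → Set ℕ) (B : Finset (List Bool) → Set ℕ),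
    (∀ c, (B c).Infinite) ∧ ∀ E J : Finset (ℕ → Bool), Disjoint E J →
      ∃ c, ∀ m ∈ B c, (∀ a ∈ E, m ∈ A a) ∧ ∀ b ∈ J, m ∉ A b := by
  obtain ⟨g⟩ : Nonempty (ℕ ≃ ℕ × Finset (List Bool)) := nonempty_equiv_of_countable
  let res : (ℕ → Bool) → ℕ → List Bool := fun a n => (List.range n).map a
  refine ⟨fun a => {m | ∃ n, res a n ∈ (g m).2}, fun c => {m | (g m).2 = c}, ?_, ?_⟩
  · intro c
    have hinj : Function.Injective (fun k : ℕ => g.symm (k, c)) := by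
      intro k l h
      simpa using h
    refine (Set.infinite_range_of_injective hinj).mono ?_
    rintro _ ⟨k, rfl⟩
    simp
  · intro E J hEJ
    have hev : ∀ᶠ n in Filter.atTop, ∀ a ∈ E, ∀ b ∈ J, res a n ≠ res b n := by
      rw [Filter.eventually_all_finset]
      intro a ha
      rw [Filter.eventually_all_finset]
      intro b hb
      have hab : a ≠ b := fun h => Finset.disjoint_left.1 hEJ ha (h ▸ hb)
      obtain ⟨k, hk⟩ := Function.ne_iff.1 hab
      filter_upwards [Filter.eventually_gt_atTop k] with n hn heq
      apply hk
      exact List.map_inj_left.1 heq k (List.mem_range.2 hn)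
    obtain ⟨N, hN⟩ := hev.exists
    classical
    refine ⟨E.image (fun a => res a N), ?_⟩
    intro m hm
    simp only [Set.mem_ofPred_eq] at hm ⊢
    rw [hm]
    refine ⟨fun a ha => ⟨N, Finset.mem_image_of_mem _ ha⟩, ?_⟩
    rintro b hb ⟨n, hn⟩
    obtain ⟨a, ha, hab⟩ := Finset.mem_image.1 hn
    have hlen := congrArg List.length hab
    simp only [res, List.length_map, List.length_range] at hlen
    subst hlen
    exact hN a ha b hb hab

end QTop

open QTop in
/-- CH implies the existence of a Tukey-top q-point: an ultrafilter `U` on `ℕ` that has a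
selector for every partition of `ℕ` into finite sets, together with a continuum-sized
family of members of `U` such that the intersection of any countably infinite subfamily
is not in `U` (Isbell's characterization of being Tukey-top). -/
theorem stmt18 (hCH : (2 : Cardinal) ^ Cardinal.aleph0 = Cardinal.aleph 1) :
    ∃ U : Ultrafilter ℕ,
      (∀ I : ℕ → Set ℕ, (Pairwise fun m n => Disjoint (I m) (I n)) →
        (∀ n, (I n).Finite) → (⋃ n, I n) = Set.univ →
        ∃ X ∈ U, ∀ n, (X ∩ I n).Subsingleton) ∧
      ∃ (ι : Type) (A : ι → Set ℕ), Cardinal.mk ι = Cardinal.continuum ∧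
        (∀ i, A i ∈ U) ∧
        ∀ I : Set ι, I.Countable → I.Infinite → (⋂ i ∈ I, A i) ∉ U := by
  classical
  obtain ⟨A, B, hB, hAB⟩ := exists_indep
  let P : Type := {I : ℕ → Set ℕ // IsPart I}
  have hCH0 : (2 : Cardinal.{0}) ^ Cardinal.aleph0.{0} = Cardinal.aleph.{0} 1 := by
    apply Cardinal.lift_injective
    rw [Cardinal.lift_power, Cardinal.lift_aleph, Cardinal.lift_aleph0, Ordinal.lift_one,
      Cardinal.lift_ofNat]
    exact hCH
  have hP : Cardinal.mk P ≤ Cardinal.aleph 1 := by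
    refine (Cardinal.mk_subtype_le _).trans ?_
    rw [← hCH0]
    simp [Cardinal.mk_set, ← Cardinal.power_mul]
  let Q : Type := (Cardinal.mk P).ord.ToType
  obtain ⟨e⟩ : Nonempty (Q ≃ P) := Cardinal.eq.1 (Cardinal.mk_ord_toType _)
  have hcount : ∀ p : Q, (Set.Iio p).Countable := by
    intro p
    have h1 : Cardinal.mk (Set.Iio p) < Cardinal.mk P := Cardinal.mk_Iio_toType_ord_lt p
    have h2 := h1.trans_le hP
    rw [← Set.countable_coe_iff, ← Cardinal.mk_le_aleph0_iff, ← Order.lt_succ_iff,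
      Cardinal.succ_aleph0]
    exact h2
  obtain ⟨X, hX1, hX2⟩ := exists_tower hcount (fun p => (e p).1) (fun p => (e p).2) B hB
  let base : Finset Q → Finset (ℕ → Bool) → Finset (Set (ℕ → Bool)) → Set ℕ :=
    fun s E T => {m | (∀ p ∈ s, m ∈ X p) ∧ (∀ a ∈ E, m ∈ A a) ∧ ∀ J ∈ T, ∃ b ∈ J, m ∉ A b}
  let F : Filter ℕ :=
    { sets := {Y | ∃ s E T, (∀ J ∈ T, J.Infinite) ∧ base s E T ⊆ Y}
      univ_sets := ⟨∅, ∅, ∅, by simp, Set.subset_univ _⟩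
      sets_of_superset := by
        rintro Y Z ⟨s, E, T, hT, h⟩ hYZ
        exact ⟨s, E, T, hT, h.trans hYZ⟩
      inter_sets := by
        rintro Y Z ⟨s, E, T, hT, h⟩ ⟨s', E', T', hT', h'⟩
        refine ⟨s ∪ s', E ∪ E', T ∪ T', ?_, ?_⟩
        · intro J hJ
          rcases Finset.mem_union.1 hJ with hJ | hJ
          · exact hT J hJ
          · exact hT' J hJ
        · rintro m ⟨h1, h2, h3⟩
          exact ⟨h ⟨fun p hp => h1 p (Finset.mem_union_left _ hp),
              fun p hp => h2 p (Finset.mem_union_left _ hp),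
              fun p hp => h3 p (Finset.mem_union_left _ hp)⟩,
            h' ⟨fun p hp => h1 p (Finset.mem_union_right _ hp),
              fun p hp => h2 p (Finset.mem_union_right _ hp),
              fun p hp => h3 p (Finset.mem_union_right _ hp)⟩⟩ }
  have hF : ∀ Y, Y ∈ F ↔ ∃ s E T, (∀ J ∈ T, J.Infinite) ∧ base s E T ⊆ Y := fun Y => Iff.rfl
  have hne : F.NeBot := by
    rw [Filter.neBot_iff]
    intro hbot
    have : (∅ : Set ℕ) ∈ F := by rw [hbot]; exact Filter.mem_bot
    obtain ⟨s, E, T, hT, h⟩ := (hF _).1 this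
    have hch : ∀ J : Set (ℕ → Bool), ∃ b, J ∈ T → b ∈ J ∧ b ∉ E := by
      intro J
      by_cases hJ : J ∈ T
      · obtain ⟨b, hb, hbE⟩ := (hT J hJ).exists_notMem_finset E
        exact ⟨b, fun _ => ⟨hb, hbE⟩⟩
      · exact ⟨fun _ => true, fun h => absurd h hJ⟩
    choose b hb using hch
    have hdis : Disjoint E (T.image b) := by
      rw [Finset.disjoint_right]
      intro x hx
      obtain ⟨J, hJ, rfl⟩ := Finset.mem_image.1 hx
      exact (hb J hJ).2
    obtain ⟨c, hc⟩ := hAB E (T.image b) hdis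
    obtain ⟨m, hm1, hm2⟩ := (hX2 s c).nonempty
    refine h (a := m) ⟨by simpa using hm1, (hc m hm2).1, ?_⟩
    intro J hJ
    exact ⟨b J, (hb J hJ).1, (hc m hm2).2 _ (Finset.mem_image_of_mem _ hJ)⟩
  have hle : ∀ Y ∈ F, Y ∈ Ultrafilter.of F := fun Y hY => Ultrafilter.of_le F hY
  refine ⟨Ultrafilter.of F, ?_, ℕ → Bool, A, by simp, ?_, ?_⟩
  · intro I h1 h2 h3
    let p : P := ⟨I, h1, h2, h3⟩
    have hp := hX1 (e.symm p)
    rw [Equiv.apply_symm_apply] at hp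
    refine ⟨X (e.symm p), hle _ ((hF _).2 ⟨{e.symm p}, ∅, ∅, by simp, ?_⟩), hp⟩
    rintro m ⟨hm, -⟩
    exact hm _ (Finset.mem_singleton_self _)
  · intro a
    refine hle _ ((hF _).2 ⟨∅, {a}, ∅, by simp, ?_⟩)
    rintro m ⟨-, hm, -⟩
    exact hm a (Finset.mem_singleton_self a)
  · intro J _ hJ
    rw [← Ultrafilter.compl_mem_iff_notMem]
    refine hle _ ((hF _).2 ⟨∅, ∅, {J}, by simpa using hJ, ?_⟩)
    rintro m ⟨-, -, hm⟩ hmem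
    obtain ⟨b, hb, hmb⟩ := hm J (Finset.mem_singleton_self J)
    exact hmb (Set.mem_iInter₂.1 hmem b hb)
end

section
/- Let λ be a cardinal and let U be an ultrafilter on ℕ such that ◇⁻_λ(U) holds. Then there is a family ⟨A_α : α < λ⟩ of elements of U such that for every countably infinite set I of indices α < λ, the subfamily ⟨A_α : α ∈ I⟩ has no pseudo-intersection in U; that is, there is no X ∈ U such that X ∖ A_α is finite for every α ∈ I. -/
/-- `◇⁻_λ(U)` yields a `λ`-indexed family of members of `U` such that no countably
infinite subfamily has a pseudo-intersection in `U`. -/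
theorem stmt19 (lam : Cardinal.{0}) (U : Ultrafilter ℕ)
    (h : DiamondMinusLambda lam U) :
    ∃ (ι : Type) (A : ι → Set ℕ), Cardinal.mk ι = lam ∧
      (∀ i, A i ∈ U) ∧
      ∀ I : Set ι, I.Countable → I.Infinite →
        ¬ ∃ X ∈ U, ∀ i ∈ I, (X \ A i).Finite := by
  obtain ⟨π, f, T, hT, hsky, 𝒜, -, hcard, hmem⟩ := h
  refine ⟨T, fun X => {n | (X : Set ℕ) ∩ Set.Iio (f n) ∈ 𝒜 n}, hT, fun X => hmem X X.2, ?_⟩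
  rintro I - hI ⟨Y, hY, hfin⟩
  let e := hI.natEmbedding
  let X : ℕ → Set ℕ := fun i => ((e i : T) : Set ℕ)
  have hXinj : Function.Injective X := fun i j hij =>
    e.injective (Subtype.ext (Subtype.ext hij))
  have hd : ∀ i j, ∃ d, i ≠ j → ¬ (d ∈ X i ↔ d ∈ X j) := by
    intro i j
    by_contra hcon
    push Not at hcon
    exact (hcon 0).1 (hXinj (Set.ext fun x => (hcon x).2))
  choose d hd using hd
  have hb : ∀ i, ∃ b, ∀ n ∈ Y, b ≤ n → X i ∩ Set.Iio (f n) ∈ 𝒜 n := by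
    intro i
    obtain ⟨b, hb⟩ := (hfin (e i : T) (e i).2).bddAbove
    refine ⟨b + 1, fun n hn hbn => ?_⟩
    by_contra hcon
    have : n ≤ b := hb ⟨hn, hcon⟩
    omega
  choose b hb using hb
  let m : ℕ → ℕ := fun k => ∑ i ∈ Finset.range (k + 1), b i
  let h : ℕ → ℕ := fun k =>
    (∑ i ∈ Finset.range (k + 1), ∑ j ∈ Finset.range (k + 1), d i j) +
      ∑ n ∈ Finset.range (m k), f n
  obtain ⟨n, hnY, hn⟩ := U.nonempty_of_mem (Filter.inter_mem hY (hsky h))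
  have hn : h (π n) < f n := hn
  have hmn : m (π n) ≤ n := by
    by_contra hcon
    have h1 : f n ≤ ∑ n ∈ Finset.range (m (π n)), f n :=
      Finset.single_le_sum (f := f) (fun _ _ => Nat.zero_le _)
        (Finset.mem_range.2 (not_le.1 hcon))
    have h2 : ∑ n ∈ Finset.range (m (π n)), f n ≤ h (π n) := Nat.le_add_left _ _
    omega
  have hdn : ∀ i ∈ Finset.range (π n + 1), ∀ j ∈ Finset.range (π n + 1), d i j < f n := by
    intro i hi j hj
    have h1 : d i j ≤ ∑ j ∈ Finset.range (π n + 1), d i j :=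
      Finset.single_le_sum (f := fun j => d i j) (fun _ _ => Nat.zero_le _) hj
    have h2 : ∑ j ∈ Finset.range (π n + 1), d i j ≤
        ∑ i ∈ Finset.range (π n + 1), ∑ j ∈ Finset.range (π n + 1), d i j :=
      Finset.single_le_sum (f := fun i => ∑ j ∈ Finset.range (π n + 1), d i j)
        (fun _ _ => Nat.zero_le _) hi
    have h3 : ∑ i ∈ Finset.range (π n + 1), ∑ j ∈ Finset.range (π n + 1), d i j ≤ h (π n) :=
      Nat.le_add_right _ _
    omega
  have hle : (Finset.range (π n + 1)).card ≤ (𝒜 n).card := by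
    refine Finset.card_le_card_of_injOn (fun i => X i ∩ Set.Iio (f n)) ?_ ?_
    · intro i hi
      have h1 : b i ≤ m (π n) :=
        Finset.single_le_sum (f := b) (fun _ _ => Nat.zero_le _) hi
      exact hb i n hnY (h1.trans hmn)
    · intro i hi j hj hij
      by_contra hne
      have h1 := hdn i hi j hj
      apply hd i j hne
      have h2 := Set.ext_iff.1 hij (d i j)
      simpa [h1] using h2
  have := hcard n
  rw [Finset.card_range] at hle
  omega
end
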